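/- The following are equivalent: (1) for every R > 0, limsup_{T→∞} |I_R ∩ [0,T]|/T > 0; (2) there exists R > 0 such that limsup_{T→∞} |I_R ∩ [0,T]|/T > 0; (3) (a,b) ∈ W₂′. -/

import Mathlib

open MeasureTheory Matrix Filter Topology ENNReal

noncomputable section

/-- `g_t = diag(e^{2t}, e^{-t}, e^{-t})`. -/
def gmat (t : ℝ) : Matrix (Fin 3) (Fin 3) ℝ :=
  Matrix.diagonal ![Real.exp (2*t), Real.exp (-t), Real.exp (-t)]

/-- `φ_{a,b}(s)`, the unipotent matrix with first row `(1, s, as+b)`. -/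
def phimat (a b s : ℝ) : Matrix (Fin 3) (Fin 3) ℝ :=
  !![1, s, a*s+b; 0, 1, 0; 0, 0, 1]

/-- `sup_{s ∈ [s₁,s₂]} ‖g_t φ_{a,b}(s) v‖` for an integer vector `v`, where `ℝ³`
carries the supremum norm. -/
def supNormOrbit (a b s₁ s₂ t : ℝ) (v : Fin 3 → ℤ) : ℝ :=
  ⨆ s : Set.Icc s₁ s₂, ‖(gmat t * phimat a b (s : ℝ)).mulVec (fun i => (v i : ℝ))‖

/-- `(a,b) ∈ W₂′` : there exists `ε > 0` such that the system
`|qb+p₁| ≤ q^{-(2+ε)}`, `|qa+p₂| ≤ q^{-(2+ε)}` has infinitely many solutions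
`(p₁,p₂,q) ∈ ℤ × ℤ × ℤ₊`. -/
def W2' (a b : ℝ) : Prop :=
  ∃ ε > (0:ℝ), {x : ℤ × ℤ × ℤ | 0 < x.2.2 ∧
    |(x.2.2 : ℝ) * b + (x.1 : ℝ)| ≤ (x.2.2 : ℝ) ^ (-(2 + ε) : ℝ) ∧
    |(x.2.2 : ℝ) * a + (x.2.1 : ℝ)| ≤ (x.2.2 : ℝ) ^ (-(2 + ε) : ℝ)}.Infinite

/-- `I_R` : the set of times `t ≥ 0` for which some nonzero integer vector `v`
satisfies `sup_{s∈I} ‖g_t φ_{a,b}(s) v‖ < R`. -/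
def IRset (a b s₁ s₂ R : ℝ) : Set ℝ :=
  {t : ℝ | 0 ≤ t ∧ ∃ v : Fin 3 → ℤ, v ≠ 0 ∧ supNormOrbit a b s₁ s₂ t v < R}

lemma orbit_coords (a b s t : ℝ) (v : Fin 3 → ℤ) :
    (gmat t * phimat a b s).mulVec (fun i => (v i : ℝ)) =
      ![Real.exp (2*t) * (((v 2 : ℝ) * b + v 0) + s * ((v 2 : ℝ) * a + v 1)),
        Real.exp (-t) * v 1, Real.exp (-t) * v 2] := by
  ext i
  fin_cases i <;>
  simp [gmat, phimat, Matrix.mulVec, dotProduct, Fin.sum_univ_three, Matrix.diagonal_mul] <;> ring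

lemma orbit_bdd (a b s₁ s₂ t : ℝ) (v : Fin 3 → ℤ) :
    BddAbove (Set.range (fun s : Set.Icc s₁ s₂ =>
      ‖(gmat t * phimat a b (s : ℝ)).mulVec (fun i => (v i : ℝ))‖)) := by
  have hc : Continuous (fun s : Set.Icc s₁ s₂ =>
      ‖(gmat t * phimat a b (s : ℝ)).mulVec (fun i => (v i : ℝ))‖) := by
    simp only [orbit_coords]
    refine continuous_norm.comp (continuous_pi fun i => ?_)
    fin_cases i <;> simp <;> fun_prop
  exact (isCompact_range hc).bddAbove

lemma extract (a b s₁ s₂ R : ℝ) (h : s₁ < s₂) (hR : 0 < R) :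
    ∃ C > (0:ℝ), ∃ T0 : ℝ, ∀ t ∈ IRset a b s₁ s₂ R, T0 ≤ t →
      ∃ p₁ p₂ q : ℤ, 0 < q ∧ (q:ℝ) ≤ C * Real.exp t ∧
        |(q:ℝ) * b + p₁| ≤ C * Real.exp (-(2*t)) ∧ |(q:ℝ) * a + p₂| ≤ C * Real.exp (-(2*t)) := by
  have hd : 0 < s₂ - s₁ := by linarith
  set D := 2 * R / (s₂ - s₁) with hD
  have hD0 : 0 < D := by positivity
  set C := R + (|s₁| + 1) * D with hC
  have hCR : R ≤ C := by
    have : 0 ≤ (|s₁| + 1) * D := by positivity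
    linarith
  have hCD : D ≤ C := by
    have : 0 ≤ |s₁| * D := by positivity
    nlinarith
  have hC0 : 0 < C := by linarith
  have hlim : ∀ᶠ t : ℝ in atTop, C * Real.exp (-(2*t)) < 1 := by
    have h1 : Tendsto (fun t : ℝ => C * Real.exp (-(2*t))) atTop (𝓝 (C * 0)) := by
      refine Tendsto.const_mul _ (Real.tendsto_exp_neg_atTop_nhds_zero.comp ?_)
      exact tendsto_id.const_mul_atTop (by norm_num)
    rw [mul_zero] at h1
    exact h1.eventually (gt_mem_nhds one_pos)
  obtain ⟨T0, hT0⟩ := eventually_atTop.1 hlim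
  refine ⟨C, hC0, T0, ?_⟩
  rintro t ⟨ht, v, hv, hsup⟩ hTt
  have hE := hT0 t hTt
  have key : ∀ s ∈ Set.Icc s₁ s₂,
      |((v 2 : ℝ) * b + v 0) + s * ((v 2 : ℝ) * a + v 1)| ≤ R * Real.exp (-(2*t)) ∧
      |(v 2 : ℝ)| ≤ R * Real.exp t := by
    intro s hs
    have h1 := lt_of_le_of_lt (le_ciSup (orbit_bdd a b s₁ s₂ t v) ⟨s, hs⟩) hsup
    simp only [orbit_coords] at h1
    have h2 := (norm_le_pi_norm _ (0 : Fin 3)).trans h1.le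
    have h3 := (norm_le_pi_norm _ (2 : Fin 3)).trans h1.le
    simp only [Matrix.cons_val, Real.norm_eq_abs, abs_mul, Real.abs_exp] at h2 h3
    constructor
    · rw [Real.exp_neg, ← div_eq_mul_inv, le_div_iff₀ (Real.exp_pos _)]; linarith
    · rw [Real.exp_neg, inv_mul_le_iff₀ (Real.exp_pos _)] at h3; linarith
  obtain ⟨k1, k3⟩ := key s₁ ⟨le_refl _, h.le⟩
  obtain ⟨k2, -⟩ := key s₂ ⟨h.le, le_refl _⟩
  set A : ℝ := (v 2 : ℝ) * b + v 0 with hA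
  set B : ℝ := (v 2 : ℝ) * a + v 1 with hB
  set E := Real.exp (-(2*t)) with hEdef
  have hE0 : 0 < E := Real.exp_pos _
  have hBD : |B| ≤ D * E := by
    have h1 : (s₂ - s₁) * |B| ≤ 2 * R * E := by
      rw [← abs_of_pos hd, ← abs_mul]
      have : (s₂ - s₁) * B = (A + s₂ * B) - (A + s₁ * B) := by ring
      rw [this]
      have := abs_sub (A + s₂ * B) (A + s₁ * B)
      linarith
    rw [hD, div_mul_eq_mul_div, le_div_iff₀ hd]; linarith
  have hBC : |B| ≤ C * E := hBD.trans (mul_le_mul_of_nonneg_right hCD hE0.le)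
  have hAC : |A| ≤ C * E := by
    have : A = (A + s₁ * B) - s₁ * B := by ring
    have h1 : |A| ≤ |A + s₁ * B| + |s₁ * B| := by
      conv_lhs => rw [this]
      exact abs_sub _ _
    rw [abs_mul] at h1
    have h2 : |s₁| * |B| ≤ |s₁| * (D * E) := mul_le_mul_of_nonneg_left hBD (abs_nonneg _)
    have h3 : 0 < D * E := by positivity
    rw [hC]; nlinarith
  have hq : |(v 2 : ℝ)| ≤ C * Real.exp t :=
    k3.trans (mul_le_mul_of_nonneg_right hCR (Real.exp_pos _).le)
  rcases lt_trichotomy (v 2) 0 with h0 | h0 | h0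
  · refine ⟨-v 0, -v 1, -v 2, by omega, ?_, ?_, ?_⟩
    · push_cast; exact (neg_le_abs _).trans hq
    · have : ((-v 2 : ℤ) : ℝ) * b + ((-v 0 : ℤ) : ℝ) = -A := by push_cast; ring
      rw [this, abs_neg]; exact hAC
    · have : ((-v 2 : ℤ) : ℝ) * a + ((-v 1 : ℤ) : ℝ) = -B := by push_cast; ring
      rw [this, abs_neg]; exact hBC
  · exfalso
    apply hv
    have e0 : v 0 = 0 := by
      have : |(v 0 : ℝ)| < 1 := by
        have : A = v 0 := by rw [hA, h0]; simp
        rw [← this]; linarith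
      exact Int.abs_lt_one_iff.1 (by exact_mod_cast this)
    have e1 : v 1 = 0 := by
      have : |(v 1 : ℝ)| < 1 := by
        have : B = v 1 := by rw [hB, h0]; simp
        rw [← this]; linarith
      exact Int.abs_lt_one_iff.1 (by exact_mod_cast this)
    ext i; fin_cases i <;> simp [e0, e1, h0]
  · exact ⟨v 0, v 1, v 2, h0, (le_abs_self _).trans hq, hAC, hBC⟩

lemma insertI (a b s₁ s₂ R : ℝ) (h : s₁ < s₂) (hR : 0 < R) :
    ∃ c > (0:ℝ), ∀ t : ℝ, 0 ≤ t → ∀ p₁ p₂ q : ℤ, 0 < q → (q:ℝ) ≤ c * Real.exp t →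
        |(q:ℝ) * b + p₁| ≤ c * Real.exp (-(2*t)) → |(q:ℝ) * a + p₂| ≤ c * Real.exp (-(2*t)) →
        t ∈ IRset a b s₁ s₂ R := by
  set M := |s₁| + |s₂| with hM
  have hM0 : 0 ≤ M := by positivity
  set N := 2 + |a| + M with hN
  have hN0 : 0 < N := by positivity
  refine ⟨R / (2 * N), by positivity, ?_⟩
  set c := R / (2 * N) with hc
  have hc0 : 0 < c := by positivity
  have hcN : c * N = R / 2 := by rw [hc]; field_simp
  intro t ht p₁ p₂ q hq hqc h1 h2
  refine ⟨ht, ![p₁, p₂, q], ?_, ?_⟩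
  · intro h0
    have := congrFun h0 2
    simp at this; omega
  have : Nonempty (Set.Icc s₁ s₂) := ⟨⟨s₁, le_refl _, h.le⟩⟩
  refine lt_of_le_of_lt (b := R / 2) (ciSup_le ?_) (by linarith)
  rintro ⟨s, hs⟩
  have hsM : |s| ≤ M := by
    rw [abs_le]
    have := neg_abs_le s₁; have := le_abs_self s₂
    have := abs_nonneg s₁; have := abs_nonneg s₂
    constructor <;> linarith [hs.1, hs.2]
  have hqR : (0:ℝ) < q := by exact_mod_cast hq
  have hEE : Real.exp (2*t) * Real.exp (-(2*t)) = 1 := by rw [← Real.exp_add]; simp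
  have hee : Real.exp (-t) * Real.exp t = 1 := by rw [← Real.exp_add]; simp
  have hE1 : Real.exp (-(2*t)) ≤ 1 := Real.exp_le_one_iff.2 (by linarith)
  have he1 : Real.exp (-t) ≤ 1 := Real.exp_le_one_iff.2 (by linarith)
  have hp := Real.exp_pos (2*t)
  have hp' := Real.exp_pos (-t)
  simp only [orbit_coords]
  rw [pi_norm_le_iff_of_nonneg (by linarith)]
  intro i
  fin_cases i
  · simp only [Matrix.cons_val, Real.norm_eq_abs, abs_mul, Real.abs_exp, Fin.zero_eta]
    have h3 : |((q:ℝ) * b + p₁) + s * ((q:ℝ) * a + p₂)| ≤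
        c * Real.exp (-(2*t)) * (1 + M) := by
      refine (abs_add_le _ _).trans ?_
      rw [abs_mul]
      have := mul_le_mul hsM h2 (abs_nonneg _) hM0
      linarith
    calc _ ≤ Real.exp (2*t) * (c * Real.exp (-(2*t)) * (1 + M)) :=
          mul_le_mul_of_nonneg_left h3 hp.le
      _ = (Real.exp (2*t) * Real.exp (-(2*t))) * (c * (1 + M)) := by ring
      _ = c * (1 + M) := by rw [hEE, one_mul]
      _ ≤ c * N := mul_le_mul_of_nonneg_left (by rw [hN]; linarith [abs_nonneg a]) hc0.le
      _ = R / 2 := hcN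
  · simp only [Matrix.cons_val, Real.norm_eq_abs, abs_mul, Real.abs_exp, Fin.mk_one]
    have h3 : |(p₂:ℝ)| ≤ c + |a| * (c * Real.exp t) := by
      have : (p₂:ℝ) = (q * a + p₂) - q * a := by ring
      rw [this]
      refine (abs_sub _ _).trans ?_
      rw [abs_mul, abs_of_pos hqR]
      have := mul_le_mul_of_nonneg_left hqc (abs_nonneg a)
      have := mul_le_mul_of_nonneg_left hE1 hc0.le
      linarith
    calc _ ≤ Real.exp (-t) * (c + |a| * (c * Real.exp t)) :=
          mul_le_mul_of_nonneg_left h3 hp'.le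
      _ = Real.exp (-t) * c + (Real.exp (-t) * Real.exp t) * (|a| * c) := by ring
      _ ≤ 1 * c + 1 * (|a| * c) := by rw [hee]; gcongr
      _ = c * (1 + |a|) := by ring
      _ ≤ c * N := mul_le_mul_of_nonneg_left (by rw [hN]; linarith) hc0.le
      _ = R / 2 := hcN
  · simp only [Matrix.cons_val, Real.norm_eq_abs, abs_mul, Real.abs_exp, Fin.reduceFinMk]
    rw [abs_of_pos hqR]
    calc _ ≤ Real.exp (-t) * (c * Real.exp t) := mul_le_mul_of_nonneg_left hqc hp'.le
      _ = (Real.exp (-t) * Real.exp t) * c := by ring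
      _ = c * 1 := by rw [hee]; ring
      _ ≤ c * N := mul_le_mul_of_nonneg_left (by rw [hN]; linarith [abs_nonneg a]) hc0.le
      _ = R / 2 := hcN

lemma meas_le (S : Set ℝ) (T : ℝ) (hT : 0 ≤ T) :
    (volume (S ∩ Set.Icc 0 T)).toReal ≤ T := by
  have h1 : volume (S ∩ Set.Icc 0 T) ≤ ENNReal.ofReal T := by
    refine (measure_mono Set.inter_subset_right).trans ?_
    rw [Real.volume_Icc, sub_zero]
  exact ENNReal.toReal_le_of_le_ofReal hT h1

lemma ratio_le (S : Set ℝ) : ∀ᶠ T : ℝ in atTop,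
    (volume (S ∩ Set.Icc 0 T)).toReal / T ≤ 1 := by
  filter_upwards [eventually_gt_atTop 0] with T hT
  rw [div_le_one hT]; exact meas_le S T hT.le

lemma ratio_nonneg (S : Set ℝ) : ∀ᶠ T : ℝ in atTop,
    0 ≤ (volume (S ∩ Set.Icc 0 T)).toReal / T := by
  filter_upwards [eventually_gt_atTop 0] with T hT
  positivity

lemma unbounded_q (a b ε : ℝ) (hε : 0 < ε)
    (hinf : {x : ℤ × ℤ × ℤ | 0 < x.2.2 ∧
    |(x.2.2 : ℝ) * b + (x.1 : ℝ)| ≤ (x.2.2 : ℝ) ^ (-(2 + ε) : ℝ) ∧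
    |(x.2.2 : ℝ) * a + (x.2.1 : ℝ)| ≤ (x.2.2 : ℝ) ^ (-(2 + ε) : ℝ)}.Infinite) (N : ℝ) :
    ∃ p₁ p₂ q : ℤ, 0 < q ∧ N < q ∧ |(q:ℝ) * b + p₁| ≤ (q:ℝ) ^ (-(2 + ε) : ℝ) ∧
      |(q:ℝ) * a + p₂| ≤ (q:ℝ) ^ (-(2 + ε) : ℝ) := by
  by_contra! hcon
  apply hinf
  set M : ℤ := ⌈|N| * (|a| + |b|) + 1 + |N|⌉ with hM
  have hMl : |N| * (|a| + |b|) + 1 + |N| ≤ M := Int.le_ceil _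
  refine (Set.finite_Icc ((-M, -M, -M) : ℤ × ℤ × ℤ) (M, M, M)).subset ?_
  rintro ⟨p₁, p₂, q⟩ ⟨hq, h1, h2⟩
  simp only at hq h1 h2
  have hqN : (q:ℝ) ≤ N := by
    by_contra! hlt
    exact absurd h2 (not_le.2 (hcon p₁ p₂ q hq hlt h1))
  have hq1 : (1:ℝ) ≤ q := by exact_mod_cast hq
  have hle : (q:ℝ) ^ (-(2 + ε) : ℝ) ≤ 1 := Real.rpow_le_one_of_one_le_of_nonpos hq1 (by linarith)
  have hqN' : (q:ℝ) ≤ |N| := hqN.trans (le_abs_self _)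
  have bound : ∀ (x : ℝ) (p : ℤ), |x| ≤ |a| + |b| → |(q:ℝ) * x + p| ≤ 1 → |p| ≤ M := by
    intro x p hx hp
    have h3 : |(p:ℝ)| ≤ 1 + |N| * (|a| + |b|) := by
      have : (p:ℝ) = (q * x + p) - q * x := by ring
      rw [this]
      refine (abs_sub _ _).trans ?_
      rw [abs_mul, abs_of_pos (by linarith : (0:ℝ) < q)]
      have := mul_le_mul hqN' hx (abs_nonneg _) (abs_nonneg _)
      linarith
    have : |(p:ℝ)| ≤ M := by linarith [abs_nonneg N]
    exact_mod_cast this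
  have b1 := abs_le.1 (bound b p₁ (by linarith [abs_nonneg a]) (h1.trans hle))
  have b2 := abs_le.1 (bound a p₂ (by linarith [abs_nonneg b]) (h2.trans hle))
  have b3 : q ≤ M := by
    have : (q:ℝ) ≤ M := by
      have : 0 ≤ |N| * (|a| + |b|) := by positivity
      linarith
    exact_mod_cast this
  simp only [Set.mem_Icc, Prod.mk_le_mk]
  refine ⟨⟨b1.1, b2.1, by omega⟩, b1.2, b2.2, b3⟩

lemma three_one (a b s₁ s₂ : ℝ) (h : s₁ < s₂) (hW : W2' a b) (R : ℝ) (hR : 0 < R) :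
    0 < Filter.limsup
          (fun T : ℝ => (volume (IRset a b s₁ s₂ R ∩ Set.Icc 0 T)).toReal / T) atTop := by
  obtain ⟨ε, hε, hinf⟩ := hW
  obtain ⟨c, hc0, hc⟩ := insertI a b s₁ s₂ R h hR
  have hκ : 0 < (ε / 4) / (1 + ε / 2) := by positivity
  refine lt_of_lt_of_le hκ (le_limsup_of_frequently_le ?_ ⟨1, by simpa using ratio_le _⟩)
  rw [frequently_atTop]
  intro T0
  set K := |Real.log c| with hK
  have hK0 : 0 ≤ K := abs_nonneg _
  set L := |T0| + 8 * K / ε + 1 with hL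
  obtain ⟨p₁, p₂, q, hq, hN, h1, h2⟩ := unbounded_q a b ε hε hinf (Real.exp L)
  have hqR : (0:ℝ) < q := by exact_mod_cast hq
  set l := Real.log q with hl
  have hlL : L < l := (Real.lt_log_iff_exp_lt hqR).2 hN
  have hql : (q:ℝ) = Real.exp l := (Real.exp_log hqR).symm
  have hKe : 0 ≤ 8 * K / ε := by positivity
  have hl0 : 0 < l := by linarith [abs_nonneg T0]
  have hεl : 8 * K ≤ ε * l := by
    have : 8 * K / ε ≤ l := by linarith [abs_nonneg T0]
    rw [div_le_iff₀ hε] at this; linarith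
  have hεl0 : 0 < ε * l := by positivity
  refine ⟨(1 + ε / 2) * l, by nlinarith [le_abs_self T0], ?_⟩
  have hT : 0 < (1 + ε / 2) * l := by positivity
  have hcK : Real.exp (-K) ≤ c := by
    calc _ ≤ Real.exp (Real.log c) := Real.exp_le_exp.2 (neg_abs_le _)
      _ = c := Real.exp_log hc0
  have hrp : (q:ℝ) ^ (-(2 + ε) : ℝ) = Real.exp (-(2+ε) * l) := by
    rw [Real.rpow_def_of_pos hqR, mul_comm]
  have hsub : Set.Icc (l + K) ((1 + ε / 2) * l - K) ⊆
      IRset a b s₁ s₂ R ∩ Set.Icc 0 ((1 + ε / 2) * l) := by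
    rintro t ⟨ht1, ht2⟩
    have ht0 : 0 ≤ t := by linarith
    have hcE : (q:ℝ) ^ (-(2 + ε) : ℝ) ≤ c * Real.exp (-(2*t)) := by
      rw [hrp]
      calc _ ≤ Real.exp (-K + -(2*t)) := Real.exp_le_exp.2 (by nlinarith)
        _ = Real.exp (-K) * Real.exp (-(2*t)) := Real.exp_add _ _
        _ ≤ _ := mul_le_mul_of_nonneg_right hcK (Real.exp_pos _).le
    refine ⟨hc t ht0 p₁ p₂ q hq ?_ (h1.trans hcE) (h2.trans hcE), ht0, by linarith⟩
    rw [hql]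
    calc _ ≤ Real.exp (-K + t) := Real.exp_le_exp.2 (by linarith)
      _ = Real.exp (-K) * Real.exp t := Real.exp_add _ _
      _ ≤ _ := mul_le_mul_of_nonneg_right hcK (Real.exp_pos _).le
  have hfin : volume (IRset a b s₁ s₂ R ∩ Set.Icc 0 ((1 + ε / 2) * l)) ≠ ⊤ :=
    ne_top_of_le_ne_top (by rw [Real.volume_Icc]; exact ENNReal.ofReal_ne_top)
      (measure_mono Set.inter_subset_right)
  have hmeas := ENNReal.toReal_mono hfin (measure_mono (μ := volume) hsub)
  rw [Real.volume_Icc, ENNReal.toReal_ofReal (by nlinarith)] at hmeas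
  rw [le_div_iff₀ hT]
  calc _ = ε / 4 * l := by field_simp
    _ ≤ _ := by nlinarith
    _ ≤ _ := hmeas

lemma exp_small (C κ δ : ℝ) (hκ : 0 < κ) (hδ : 0 < δ) :
    ∃ T0 : ℝ, ∀ t ≥ T0, C * Real.exp (-(κ*t)) < δ := by
  have h1 : Tendsto (fun t : ℝ => C * Real.exp (-(κ*t))) atTop (𝓝 (C * 0)) := by
    refine Tendsto.const_mul _ (Real.tendsto_exp_neg_atTop_nhds_zero.comp ?_)
    exact tendsto_id.const_mul_atTop hκ
  rw [mul_zero] at h1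
  exact eventually_atTop.1 (h1.eventually (gt_mem_nhds hδ))

/-- solutions have positive error when `(a,b)` is not in `W₂′`. -/
lemma pos_err (a b : ℝ) (hW : ¬ W2' a b) (p₁ p₂ q : ℤ) (hq : 0 < q) :
    0 < |(q:ℝ) * b + p₁| + |(q:ℝ) * a + p₂| := by
  by_contra! hcon
  have e1 : (q:ℝ) * b + p₁ = 0 := by
    apply abs_eq_zero.1; linarith [abs_nonneg ((q:ℝ) * b + p₁), abs_nonneg ((q:ℝ) * a + p₂)]
  have e2 : (q:ℝ) * a + p₂ = 0 := by
    apply abs_eq_zero.1; linarith [abs_nonneg ((q:ℝ) * b + p₁), abs_nonneg ((q:ℝ) * a + p₂)]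
  apply hW
  refine ⟨1, one_pos, ?_⟩
  refine Set.infinite_of_injective_forall_mem
    (f := fun n : ℕ => (((n:ℤ)+1) * p₁, ((n:ℤ)+1) * p₂, ((n:ℤ)+1) * q)) ?_ ?_
  · intro m n hmn
    simp only [Prod.mk.injEq] at hmn
    have := mul_right_cancel₀ hq.ne' hmn.2.2
    omega
  · intro n
    have hn : (0:ℤ) < ((n:ℤ)+1) * q := by positivity
    have hn' : (0:ℝ) ≤ ((((n:ℤ)+1) * q : ℤ) : ℝ) := by exact_mod_cast hn.le
    refine ⟨hn, ?_, ?_⟩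
    · have : ((((n:ℤ)+1) * q : ℤ) : ℝ) * b + ((((n:ℤ)+1) * p₁ : ℤ) : ℝ) = 0 := by
        push_cast; linear_combination ((n:ℝ)+1) * e1
      simp only [this, abs_zero]
      exact Real.rpow_nonneg hn' _
    · have : ((((n:ℤ)+1) * q : ℤ) : ℝ) * a + ((((n:ℤ)+1) * p₂ : ℤ) : ℝ) = 0 := by
        push_cast; linear_combination ((n:ℝ)+1) * e2
      simp only [this, abs_zero]
      exact Real.rpow_nonneg hn' _

/-- Simultaneously small `q` and small error is impossible at late times. -/
lemma no_good (a b C η : ℝ) (hC : 0 < C) (hη : 0 < η) (hW : ¬ W2' a b) :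
    ∃ T0 : ℝ, ∀ t t' : ℝ, T0 ≤ t' → t ≤ (1 - η) * t' → ∀ p₁ p₂ q : ℤ, 0 < q →
      (q:ℝ) ≤ C * Real.exp t → |(q:ℝ) * b + p₁| ≤ C * Real.exp (-(2*t')) →
      |(q:ℝ) * a + p₂| ≤ C * Real.exp (-(2*t')) → False := by
  have hfin : {x : ℤ × ℤ × ℤ | 0 < x.2.2 ∧
    |(x.2.2 : ℝ) * b + (x.1 : ℝ)| ≤ (x.2.2 : ℝ) ^ (-(2 + η) : ℝ) ∧
    |(x.2.2 : ℝ) * a + (x.2.1 : ℝ)| ≤ (x.2.2 : ℝ) ^ (-(2 + η) : ℝ)}.Finite := by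
    by_contra hinf
    exact hW ⟨η, hη, hinf⟩
  set S := {x : ℤ × ℤ × ℤ | 0 < x.2.2 ∧
    |(x.2.2 : ℝ) * b + (x.1 : ℝ)| ≤ (x.2.2 : ℝ) ^ (-(2 + η) : ℝ) ∧
    |(x.2.2 : ℝ) * a + (x.2.1 : ℝ)| ≤ (x.2.2 : ℝ) ^ (-(2 + η) : ℝ)} with hS
  have hδ : ∃ δ > (0:ℝ), ∀ x ∈ S, δ ≤ |(x.2.2:ℝ) * b + x.1| + |(x.2.2:ℝ) * a + x.2.1| := by
    rcases S.eq_empty_or_nonempty with he | hne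
    · exact ⟨1, one_pos, by simp [he]⟩
    · obtain ⟨x, hx, hmin⟩ := Set.exists_min_image S
        (fun x => |(x.2.2:ℝ) * b + x.1| + |(x.2.2:ℝ) * a + x.2.1|) hfin hne
      exact ⟨_, pos_err a b hW x.1 x.2.1 x.2.2 hx.1, hmin⟩
  obtain ⟨δ, hδ0, hδ⟩ := hδ
  obtain ⟨T1, hT1⟩ := exp_small (2*C) 2 δ (by norm_num) hδ0
  obtain ⟨T2, hT2⟩ := exp_small (C * C ^ (2+η)) (η + η^2) 1 (by positivity) one_pos
  refine ⟨max T1 T2, ?_⟩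
  intro t t' ht' htt p₁ p₂ q hq hqC h1 h2
  have hqR : (0:ℝ) < q := by exact_mod_cast hq
  have hle : C * Real.exp (-(2*t')) ≤ (q:ℝ) ^ (-(2 + η) : ℝ) := by
    rw [Real.rpow_neg hqR.le, ← one_div, le_div_iff₀ (by positivity)]
    have h3 : (q:ℝ) ^ (2 + η) ≤ C ^ (2+η) * Real.exp (t * (2+η)) := by
      calc _ ≤ (C * Real.exp t) ^ (2+η) := Real.rpow_le_rpow hqR.le hqC (by positivity)
        _ = _ := by rw [Real.mul_rpow hC.le (Real.exp_pos _).le, ← Real.exp_mul]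
    calc _ ≤ C * Real.exp (-(2*t')) * (C ^ (2+η) * Real.exp (t * (2+η))) :=
          mul_le_mul_of_nonneg_left h3 (by positivity)
      _ = C * C ^ (2+η) * Real.exp (-(2*t') + t * (2+η)) := by rw [Real.exp_add]; ring
      _ ≤ C * C ^ (2+η) * Real.exp (-((η + η^2)*t')) := by
          gcongr
          nlinarith
      _ ≤ 1 := (hT2 t' ((le_max_right _ _).trans ht')).le
  have hmem : ((p₁, p₂, q) : ℤ × ℤ × ℤ) ∈ S := ⟨hq, h1.trans hle, h2.trans hle⟩
  have h4 := hδ _ hmem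
  have h5 := hT1 t' ((le_max_left _ _).trans ht')
  simp only at h4
  linarith

lemma close_times (a b s₁ s₂ R η : ℝ) (h : s₁ < s₂) (hR : 0 < R) (hη : 0 < η)
    (hW : ¬ W2' a b) :
    ∃ T0 : ℝ, ∀ t ∈ IRset a b s₁ s₂ R, ∀ t' ∈ IRset a b s₁ s₂ R,
      T0 ≤ t → t ≤ t' → t' ≤ 3 / 2 * t → t' - t ≤ η * t' := by
  obtain ⟨C, hC, T1, hT1⟩ := extract a b s₁ s₂ R h hR
  obtain ⟨T2, hT2⟩ := no_good a b C η hC hη hW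
  obtain ⟨T3, hT3⟩ := exp_small (2 * C^2) (1/2) 1 (by norm_num) one_pos
  refine ⟨max (max T1 T2) T3, ?_⟩
  intro t ht t' ht' hT htt htt'
  have hTa : T1 ≤ t := (le_max_left _ _).trans ((le_max_left _ _).trans hT)
  have hTb : T2 ≤ t := (le_max_right _ _).trans ((le_max_left _ _).trans hT)
  have hTc : T3 ≤ t := (le_max_right _ _).trans hT
  have ht0 : 0 ≤ t := ht.1
  by_contra! hcon
  obtain ⟨p₁, p₂, q, hq, hqC, h1, h2⟩ := hT1 t ht hTa
  obtain ⟨p₁', p₂', q', hq', hqC', h1', h2'⟩ := hT1 t' ht' (hTa.trans htt)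
  have hqR : (0:ℝ) < q := by exact_mod_cast hq
  have hqR' : (0:ℝ) < q' := by exact_mod_cast hq'
  have par : ∀ (x : ℝ) (p p' : ℤ), |(q:ℝ) * x + p| ≤ C * Real.exp (-(2*t)) →
      |(q':ℝ) * x + p'| ≤ C * Real.exp (-(2*t')) → q * p' - q' * p = 0 := by
    intro x p p' hp hp'
    apply Int.abs_lt_one_iff.1
    have : |((q * p' - q' * p : ℤ) : ℝ)| < 1 := by
      have e : ((q * p' - q' * p : ℤ) : ℝ) = q * (q' * x + p') - q' * (q * x + p) := by
        push_cast; ring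
      rw [e]
      refine lt_of_le_of_lt (abs_sub _ _) ?_
      rw [abs_mul, abs_mul, abs_of_pos hqR, abs_of_pos hqR']
      have m1 := mul_le_mul hqC hp' (abs_nonneg _) (by positivity)
      have m2 := mul_le_mul hqC' hp (abs_nonneg _) (by positivity)
      have n1 : C * Real.exp t * (C * Real.exp (-(2*t'))) ≤ C^2 * Real.exp (-(1/2*t)) := by
        calc _ = C^2 * Real.exp (t + -(2*t')) := by rw [Real.exp_add]; ring
          _ ≤ _ := by gcongr; linarith
      have n2 : C * Real.exp t' * (C * Real.exp (-(2*t))) ≤ C^2 * Real.exp (-(1/2*t)) := by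
        calc _ = C^2 * Real.exp (t' + -(2*t)) := by rw [Real.exp_add]; ring
          _ ≤ _ := by gcongr; linarith
      have n3 := hT3 t hTc
      linarith
    exact_mod_cast this
  rcases le_total q' q with hqq | hqq
  · have hqq' : (q':ℝ) ≤ q := by exact_mod_cast hqq
    exact hT2 t t' (hTb.trans htt) (by linarith) p₁' p₂' q' hq' (hqq'.trans hqC) h1' h2'
  · have hqq' : (q:ℝ) ≤ q' := by exact_mod_cast hqq
    have red : ∀ (x : ℝ) (p p' : ℤ), |(q':ℝ) * x + p'| ≤ C * Real.exp (-(2*t')) →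
        q * p' - q' * p = 0 → |(q:ℝ) * x + p| ≤ C * Real.exp (-(2*t')) := by
      intro x p p' hp' hpar
      refine le_trans ?_ hp'
      have hparR : (q:ℝ) * p' - q' * p = 0 := by exact_mod_cast hpar
      have e : (q':ℝ) * (q * x + p) = q * (q' * x + p') := by linear_combination -hparR
      have e2 := congrArg abs e
      rw [abs_mul, abs_mul, abs_of_pos hqR, abs_of_pos hqR'] at e2
      have := mul_le_mul_of_nonneg_right hqq' (abs_nonneg ((q':ℝ) * x + p'))
      exact le_of_mul_le_mul_left (by linarith) hqR'
    exact hT2 t t' (hTb.trans htt) (by linarith) p₁ p₂ q hq hqC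
      (red b p₁ p₁' h1' (par b p₁ p₁' h1 h1')) (red a p₂ p₂' h2' (par a p₂ p₂' h2 h2'))

lemma growth (a b s₁ s₂ R η : ℝ) (h : s₁ < s₂) (hR : 0 < R) (hη : 0 < η)
    (hW : ¬ W2' a b) :
    ∃ T1 > (0:ℝ), ∀ T ≥ 0, (volume (IRset a b s₁ s₂ R ∩ Set.Icc 0 T)).toReal ≤ 3 * η * T + T1 := by
  obtain ⟨T0, hT0⟩ := close_times a b s₁ s₂ R η h hR hη hW
  set S := IRset a b s₁ s₂ R with hS
  set T1 := 3 / 2 * |T0| + 1 with hT1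
  have hT1p : 0 < T1 := by positivity
  have step : ∀ T, T1 ≤ T → (volume (S ∩ Set.Icc 0 T)).toReal ≤
      η * T + (volume (S ∩ Set.Icc 0 (2/3*T))).toReal := by
    intro T hT
    have hTp : 0 < T := by linarith
    have hdiam : volume (S ∩ Set.Icc (2/3*T) T) ≤ ENNReal.ofReal (η * T) := by
      refine (Real.volume_le_diam _).trans (Metric.ediam_le ?_)
      have aux : ∀ x ∈ S ∩ Set.Icc (2/3*T) T, ∀ y ∈ S ∩ Set.Icc (2/3*T) T, x ≤ y →
          y - x ≤ η * T := by
        rintro x ⟨hx, hx1, hx2⟩ y ⟨hy, hy1, hy2⟩ hxy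
        have := hT0 x hx y hy (by linarith [le_abs_self T0]) hxy (by linarith)
        nlinarith
      intro x hx y hy
      rw [edist_dist, Real.dist_eq]
      apply ENNReal.ofReal_le_ofReal
      rcases le_total x y with hxy | hxy
      · rw [abs_sub_comm, abs_of_nonneg (by linarith)]; exact aux x hx y hy hxy
      · rw [abs_of_nonneg (by linarith)]; exact aux y hy x hx hxy
    have hsub : S ∩ Set.Icc 0 T ⊆ (S ∩ Set.Icc (2/3*T) T) ∪ (S ∩ Set.Icc 0 (2/3*T)) := by
      rintro x ⟨hx, h1, h2⟩
      rcases le_total x (2/3*T) with h3 | h3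
      · exact Or.inr ⟨hx, h1, h3⟩
      · exact Or.inl ⟨hx, h3, h2⟩
    have hf : volume (S ∩ Set.Icc 0 (2/3*T)) ≠ ⊤ :=
      ne_top_of_le_ne_top (by rw [Real.volume_Icc]; exact ENNReal.ofReal_ne_top)
        (measure_mono Set.inter_subset_right)
    have hle := ((measure_mono (μ := volume) hsub).trans (measure_union_le _ _)).trans
      (add_le_add_left hdiam _)
    have := ENNReal.toReal_mono (ENNReal.add_ne_top.2 ⟨ENNReal.ofReal_ne_top, hf⟩) hle
    rwa [ENNReal.toReal_add ENNReal.ofReal_ne_top hf, ENNReal.toReal_ofReal (by positivity)] at this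
  refine ⟨T1, hT1p, ?_⟩
  have ind : ∀ n : ℕ, ∀ T ≥ 0, T ≤ (3/2:ℝ)^n * T1 →
      (volume (S ∩ Set.Icc 0 T)).toReal ≤ 3 * η * T + T1 := by
    intro n
    induction n with
    | zero =>
      intro T hT hle
      have := meas_le S T hT
      have : 0 ≤ 3 * η * T := by positivity
      simp at hle
      linarith
    | succ n ih =>
      intro T hT hle
      rcases le_total T T1 with hc | hc
      · have := meas_le S T hT
        have : 0 ≤ 3 * η * T := by positivity
        linarith
      · have h1 := step T hc
        have h2 := ih (2/3*T) (by linarith) (by rw [pow_succ] at hle; linarith)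
        linarith
  intro T hT
  obtain ⟨n, hn⟩ := pow_unbounded_of_one_lt (T / T1) (by norm_num : (1:ℝ) < 3/2)
  exact ind n T hT (by rw [div_lt_iff₀ hT1p] at hn; exact hn.le)

lemma two_three (a b s₁ s₂ R : ℝ) (h : s₁ < s₂) (hR : 0 < R)
    (hpos : 0 < Filter.limsup
          (fun T : ℝ => (volume (IRset a b s₁ s₂ R ∩ Set.Icc 0 T)).toReal / T) atTop) :
    W2' a b := by
  by_contra hW
  set L := Filter.limsup
          (fun T : ℝ => (volume (IRset a b s₁ s₂ R ∩ Set.Icc 0 T)).toReal / T) atTop with hL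
  obtain ⟨T1, hT1, hg⟩ := growth a b s₁ s₂ R (L / 8) h hR (by positivity) hW
  have hle : L ≤ L / 2 := by
    refine limsup_le_of_le
      (Filter.IsBoundedUnder.isCoboundedUnder_le ⟨0, by simpa using ratio_nonneg _⟩) ?_
    filter_upwards [eventually_ge_atTop (8 * T1 / L), eventually_gt_atTop 0] with T h1 h2
    rw [div_le_iff₀ h2]
    rw [div_le_iff₀ hpos] at h1
    have := hg T h2.le
    nlinarith
  linarith

/-- **Lemma (density of bounded times).** The following are equivalent:
(1) for every `R > 0`, `limsup_{T→∞} |I_R ∩ [0,T]|/T > 0`;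
(2) for some `R > 0`, `limsup_{T→∞} |I_R ∩ [0,T]|/T > 0`;
(3) `(a,b) ∈ W₂′`. -/
theorem density_tfae (a b s₁ s₂ : ℝ) (h : s₁ < s₂) :
    List.TFAE
      [ (∀ R > (0:ℝ), 0 < Filter.limsup
          (fun T : ℝ => (volume (IRset a b s₁ s₂ R ∩ Set.Icc 0 T)).toReal / T) atTop),
        (∃ R > (0:ℝ), 0 < Filter.limsup
          (fun T : ℝ => (volume (IRset a b s₁ s₂ R ∩ Set.Icc 0 T)).toReal / T) atTop),
        W2' a b ] := by
  tfae_have 1 → 2 := fun H => ⟨1, one_pos, H 1 one_pos⟩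
  tfae_have 2 → 3 := fun ⟨R, hR, H⟩ => two_three a b s₁ s₂ R h hR H
  tfae_have 3 → 1 := fun H R hR => three_one a b s₁ s₂ h H R hR
  tfae_finish
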